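/- Let T > 0, I = [0,T], and define b : ℝ → ℝ by b(x) = −1 for x ≥ 0 and b(x) = 1 for x < 0 (viewed as an autonomous vector field on I × ℝ). Then for every nonzero nonnegative locally finite Borel measure μ̄ concentrated on [0,T), the Cauchy problem ∂_t μ_t + div(b μ_t) = 0 with initial data μ̄ has no measurable family of nonnegative locally finite Borel measures as a measure-valued solution. -/

import Mathlib

open MeasureTheory Set Metric

noncomputable section

/-- The space `C(I; E)` of continuous curves on `I = [0,T]`, with the sup metric. -/
abbrev Curve (T : ℝ) (E : Type*) [MetricSpace E] := C(Set.Icc (0:ℝ) T, E)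

instance (T : ℝ) (E : Type*) [MetricSpace E] : MeasurableSpace (Curve T E) := borel _
instance (T : ℝ) (E : Type*) [MetricSpace E] : BorelSpace (Curve T E) := ⟨rfl⟩

/-- `Γ = Lip_M(I; E)` : the curves that are Lipschitz with constant `M`, as a metric
subspace of `C(I; E)`. -/
abbrev LipCurve (T : ℝ) (E : Type*) [MetricSpace E] (M : NNReal) :=
  {γ : Curve T E // LipschitzWith M γ}

/-- Evaluation of a curve `γ ∈ C([0,T]; E)` at a time `t : ℝ` (clamping `t` to `[0,T]`). -/
def evalC {T : ℝ} {E : Type*} [MetricSpace E] (hT : 0 ≤ T) (γ : Curve T E) (t : ℝ) : E :=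
  γ (Set.projIcc 0 T hT t)

/-- `γ` is an integral curve of `b`: `γ(t) = γ(0) + ∫₀ᵗ b(s, γ(s)) ds` for all `t ∈ [0,T]`. -/
def IsIntegralCurveOf {T : ℝ} {E : Type*} [NormedAddCommGroup E] [NormedSpace ℝ E]
    (hT : 0 ≤ T) (b : ℝ → E → E) (γ : Curve T E) : Prop :=
  ∀ t ∈ Set.Icc (0:ℝ) T,
    evalC hT γ t = evalC hT γ 0 + ∫ s in (0:ℝ)..t, b s (evalC hT γ s)

/-- A family `{μ_t}` of Borel measures is measurable: `t ↦ μ_t(B)` is (Lebesgue-)measurable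
for every bounded Borel set `B`, and `t ↦ μ_t(K)` is integrable on `[0,T]` for every
compact `K`. -/
def IsMeasurableFamily {E : Type*} [NormedAddCommGroup E] [MeasurableSpace E]
    (T : ℝ) (μ : ℝ → Measure E) : Prop :=
  (∀ B : Set E, MeasurableSet B → Bornology.IsBounded B →
      AEMeasurable (fun t => μ t B) (volume.restrict (Set.Icc (0:ℝ) T))) ∧
  (∀ K : Set E, IsCompact K →
      IntegrableOn (fun t => (μ t K).toReal) (Set.Icc (0:ℝ) T))

/-- `{μ_t}` is a measure-valued solution of `∂_t μ_t + div (b μ_t) = 0`, `μ_t|_{t=0} = μ₀`: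
for every `C¹` test function `φ(t,x)` vanishing for `(t,x) ∈ [0,T] × (E ∖ B_R(0))` for
some `R > 0`, and a.e. `t ∈ [0,T]`,
`∫ φ(t,x) dμ_t(x) = ∫ φ(0,x) dμ₀(x) + ∫₀ᵗ ∫ (∂_t φ + b ⬝ ∇_x φ) dμ_s ds`. -/
def IsMVSolution {E : Type*} [NormedAddCommGroup E] [NormedSpace ℝ E] [MeasurableSpace E]
    (T : ℝ) (b : ℝ → E → E) (μ : ℝ → Measure E) (μ₀ : Measure E) : Prop :=
  ∀ φ : ℝ × E → ℝ, ContDiff ℝ 1 φ →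
    (∃ R > (0:ℝ), ∀ t ∈ Set.Icc (0:ℝ) T, ∀ x : E, R ≤ ‖x‖ → φ (t, x) = 0) →
    ∀ᵐ t ∂(volume.restrict (Set.Icc (0:ℝ) T)),
      ∫ x, φ (t, x) ∂(μ t) =
        (∫ x, φ (0, x) ∂μ₀) +
          ∫ s in (0:ℝ)..t, (∫ x, (deriv (fun τ => φ (τ, x)) s
            + fderiv ℝ (fun y => φ (s, y)) x (b s x)) ∂(μ s))


/-- The vector field `b(x) = -1` for `x ≥ 0` and `b(x) = 1` for `x < 0`. -/
def bEx (x : ℝ) : ℝ := if 0 ≤ x then -1 else 1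

/-- A `C¹` approximation of `|x|` which equals `x` on `[0, ∞)` and has slope `-1` on
`(-∞, -ε]`. -/
def oneSidedAbs (ε x : ℝ) : ℝ := x + ((max (-x) 0) ^ 2 - (max (-x - ε) 0) ^ 2) / ε

theorem hasDerivAt_max_zero_sq (x : ℝ) :
    HasDerivAt (fun y : ℝ => (max y 0) ^ 2) (2 * max x 0) x := by
  rcases lt_trichotomy x 0 with h | h | h
  · rw [max_eq_right h.le, mul_zero]
    refine (hasDerivAt_const x (0 : ℝ)).congr_of_eventuallyEq ?_
    filter_upwards [Iio_mem_nhds h] with y hy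
    simp [max_eq_right (le_of_lt (mem_Iio.1 hy))]
  · subst h
    rw [max_self, mul_zero, hasDerivAt_iff_isLittleO]
    have h1 : (fun y : ℝ => y ^ 2) =o[nhds 0] fun y : ℝ => y := by
      simpa using Asymptotics.isLittleO_pow_pow (𝕜 := ℝ) (m := 1) (n := 2) one_lt_two
    refine Asymptotics.IsBigO.trans_isLittleO (g := fun y : ℝ => y ^ 2) ?_ (by simpa using h1)
    refine Asymptotics.IsBigO.of_bound 1 (Filter.Eventually.of_forall fun y => ?_)
    rcases le_total y 0 with hy | hy
    · simp [max_eq_right hy, sq_nonneg]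
    · simp [max_eq_left hy]
  · rw [max_eq_left h.le]
    have h1 : HasDerivAt (fun y : ℝ => y ^ 2) (2 * x) x := by simpa using hasDerivAt_pow 2 x
    refine h1.congr_of_eventuallyEq ?_
    filter_upwards [Ioi_mem_nhds h] with y hy
    simp [max_eq_left (le_of_lt (mem_Ioi.1 hy))]

theorem hasDerivAt_max_zero_sq_comp {f : ℝ → ℝ} {f' x : ℝ} (hf : HasDerivAt f f' x) :
    HasDerivAt (fun y => (max (f y) 0) ^ 2) (2 * max (f x) 0 * f') x :=
  (hasDerivAt_max_zero_sq (f x)).comp x hf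

theorem contDiff_max_zero_sq : ContDiff ℝ 1 (fun y : ℝ => (max y 0) ^ 2) := by
  rw [contDiff_one_iff_deriv]
  refine ⟨fun x => (hasDerivAt_max_zero_sq x).differentiableAt, ?_⟩
  rw [funext fun x => (hasDerivAt_max_zero_sq x).deriv]
  fun_prop

theorem contDiff_oneSidedAbs (ε : ℝ) : ContDiff ℝ 1 (oneSidedAbs ε) := by
  have h1 : ContDiff ℝ 1 (fun x : ℝ => (max (-x) 0) ^ 2) :=
    contDiff_max_zero_sq.comp contDiff_neg
  have h2 : ContDiff ℝ 1 (fun x : ℝ => (max (-x - ε) 0) ^ 2) :=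
    contDiff_max_zero_sq.comp (contDiff_neg.sub contDiff_const)
  exact contDiff_id.add ((h1.sub h2).div_const ε)

theorem hasDerivAt_oneSidedAbs (ε x : ℝ) :
    HasDerivAt (oneSidedAbs ε) (1 + (2 * max (-x - ε) 0 - 2 * max (-x) 0) / ε) x := by
  have h1 : HasDerivAt (fun x : ℝ => (max (-x) 0) ^ 2) (2 * max (-x) 0 * (-1)) x :=
    hasDerivAt_max_zero_sq_comp (hasDerivAt_neg x)
  have h2 : HasDerivAt (fun x : ℝ => (max (-x - ε) 0) ^ 2) (2 * max (-x - ε) 0 * (-1)) x :=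
    hasDerivAt_max_zero_sq_comp ((hasDerivAt_neg x).sub_const ε)
  refine ((hasDerivAt_id x).add ((h1.sub h2).div_const ε)).congr_deriv ?_
  ring

theorem abs_sub_le_oneSidedAbs {ε : ℝ} (hε : 0 < ε) (x : ℝ) : |x| - ε ≤ oneSidedAbs ε x := by
  unfold oneSidedAbs
  rcases le_total 0 x with h | h
  · rw [abs_of_nonneg h, max_eq_right (by linarith), max_eq_right (by linarith)]
    simp [hε.le]
  · rw [abs_of_nonpos h, max_eq_left (by linarith)]
    rw [← sub_le_iff_le_add', le_div_iff₀ hε]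
    rcases le_total 0 (-x - ε) with h' | h'
    · rw [max_eq_left h']; nlinarith
    · rw [max_eq_right h']; nlinarith [sq_nonneg (x + ε)]

theorem oneSidedAbs_of_nonneg {ε x : ℝ} (hε : 0 < ε) (hx : 0 ≤ x) : oneSidedAbs ε x = x := by
  simp [oneSidedAbs, hx, show -x - ε ≤ 0 by linarith]

/-- `oneSidedAbs ε` decreases at unit rate along `bEx`, except on `(-ε, 0)`. -/
theorem abs_one_add_bEx_mul_deriv_le {ε : ℝ} (hε : 0 < ε) (x : ℝ) :
    |1 + bEx x * deriv (oneSidedAbs ε) x| ≤ (Ioo (-ε) 0).indicator (fun _ => 2) x := by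
  rw [(hasDerivAt_oneSidedAbs ε x).deriv]
  unfold bEx
  rcases le_or_gt 0 x with h | h
  · rw [if_pos h, indicator_of_notMem (by simp [h]), max_eq_right (by linarith),
      max_eq_right (by linarith)]
    simp
  · rw [if_neg h.not_ge, max_eq_left (by linarith : (0:ℝ) ≤ -x)]
    rcases le_or_gt x (-ε) with h' | h'
    · rw [max_eq_left (by linarith), indicator_of_notMem (by simp [h']),
        show 1 + 1 * (1 + (2 * (-x - ε) - 2 * -x) / ε) = 0 by field_simp; ring]
      simp
    · rw [max_eq_right (by linarith), indicator_of_mem (show x ∈ Ioo (-ε) 0 from ⟨h', h⟩),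
        show 1 + 1 * (1 + (2 * 0 - 2 * -x) / ε) = (2 * (ε + x)) / ε by field_simp; ring,
        abs_of_nonneg (div_nonneg (by linarith) hε.le), div_le_iff₀ hε]
      linarith

/-- The test function `(c - t - |x|)₊²`, with `|x|` smoothed by `oneSidedAbs ε`. -/
def coneTest (c ε : ℝ) (p : ℝ × ℝ) : ℝ := (max (c - p.1 - oneSidedAbs ε p.2) 0) ^ 2

theorem contDiff_coneTest (c ε : ℝ) : ContDiff ℝ 1 (coneTest c ε) :=
  contDiff_max_zero_sq.comp
    ((contDiff_const.sub contDiff_fst).sub ((contDiff_oneSidedAbs ε).comp contDiff_snd))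

theorem coneTest_eq_zero {c ε t x : ℝ} (hε : 0 < ε) (h : c + ε ≤ t + |x|) :
    coneTest c ε (t, x) = 0 := by
  have := abs_sub_le_oneSidedAbs hε x
  simp only [coneTest]
  rw [max_eq_right (by linarith)]
  simp

theorem transport_coneTest (c ε s x v : ℝ) :
    deriv (fun τ => coneTest c ε (τ, x)) s + fderiv ℝ (fun y => coneTest c ε (s, y)) x v =
      -(2 * max (c - s - oneSidedAbs ε x) 0) * (1 + v * deriv (oneSidedAbs ε) x) := by
  have h1 : HasDerivAt (fun τ => coneTest c ε (τ, x))
      (2 * max (c - s - oneSidedAbs ε x) 0 * (-1)) s :=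
    hasDerivAt_max_zero_sq_comp
      (((hasDerivAt_id s).const_sub c).sub_const (oneSidedAbs ε x))
  have h2 : HasDerivAt (fun y => coneTest c ε (s, y))
      (2 * max (c - s - oneSidedAbs ε x) 0 * (-deriv (oneSidedAbs ε) x)) x :=
    hasDerivAt_max_zero_sq_comp
      ((hasDerivAt_oneSidedAbs ε x).differentiableAt.hasDerivAt.const_sub (c - s))
  rw [h1.deriv, h2.hasFDerivAt.fderiv]
  simp only [ContinuousLinearMap.toSpanSingleton_apply, smul_eq_mul]
  ring

theorem norm_transport_coneTest_le {c ε s : ℝ} (hc : 0 ≤ c) (hε : 0 < ε) (hs : 0 ≤ s) (x : ℝ) :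
    ‖deriv (fun τ => coneTest c ε (τ, x)) s
        + fderiv ℝ (fun y => coneTest c ε (s, y)) x (bEx x)‖ ≤
      (Ioo (-ε) 0).indicator (fun _ => 4 * (c + ε)) x := by
  rw [transport_coneTest, norm_mul, norm_neg, Real.norm_eq_abs, Real.norm_eq_abs]
  have h1 := abs_sub_le_oneSidedAbs hε x
  have h2 : |2 * max (c - s - oneSidedAbs ε x) 0| ≤ 2 * (c + ε) := by
    rw [abs_of_nonneg (by positivity)]
    have := max_le (by linarith [abs_nonneg x] : c - s - oneSidedAbs ε x ≤ c + ε)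
      (by linarith : 0 ≤ c + ε)
    linarith
  refine (mul_le_mul h2 (abs_one_add_bEx_mul_deriv_le hε x) (abs_nonneg _)
    (by linarith)).trans (le_of_eq ?_)
  by_cases hx : x ∈ Ioo (-ε) 0
  · simp only [indicator_of_mem hx]; ring
  · simp only [indicator_of_notMem hx]; ring

theorem norm_integral_transport_coneTest_le {ν : Measure ℝ} [IsLocallyFiniteMeasure ν] {c ε s : ℝ}
    (hc : 0 ≤ c) (hε : 0 < ε) (hs : 0 ≤ s) :
    ‖∫ x, (deriv (fun τ => coneTest c ε (τ, x)) s
        + fderiv ℝ (fun y => coneTest c ε (s, y)) x (bEx x)) ∂ν‖ ≤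
      4 * (c + ε) * (ν (Ioo (-ε) 0)).toReal := by
  have hfin : ν (Ioo (-ε) 0) ≠ ⊤ := measure_Ioo_lt_top.ne
  refine (norm_integral_le_of_norm_le ((integrable_indicator_iff measurableSet_Ioo).2
    (integrableOn_const hfin))
    (Filter.Eventually.of_forall (norm_transport_coneTest_le hc hε hs))).trans (le_of_eq ?_)
  rw [integral_indicator measurableSet_Ioo, setIntegral_const, smul_eq_mul, mul_comm]
  rfl

theorem IsMeasurableFamily.integrable_toReal_Ioo {T : ℝ} {μ : ℝ → Measure ℝ}
    (hfin : ∀ t ∈ Icc (0:ℝ) T, IsLocallyFiniteMeasure (μ t)) (hμ : IsMeasurableFamily T μ)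
    (a b : ℝ) : IntegrableOn (fun t => (μ t (Ioo a b)).toReal) (Icc (0:ℝ) T) := by
  refine (hμ.2 (Icc a b) isCompact_Icc).mono'
    (hμ.1 _ measurableSet_Ioo (isBounded_Ioo a b)).ennreal_toReal.aestronglyMeasurable ?_
  filter_upwards [ae_restrict_mem measurableSet_Icc] with t ht
  have := hfin t ht
  rw [Real.norm_of_nonneg ENNReal.toReal_nonneg]
  exact ENNReal.toReal_mono measure_Icc_lt_top.ne (measure_mono Ioo_subset_Icc_self)

theorem IsMeasurableFamily.tendsto_integral_toReal_Ioo {T : ℝ} {μ : ℝ → Measure ℝ}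
    (hfin : ∀ t ∈ Icc (0:ℝ) T, IsLocallyFiniteMeasure (μ t)) (hμ : IsMeasurableFamily T μ)
    {ε : ℕ → ℝ} (hanti : Antitone ε) (hε : Filter.Tendsto ε Filter.atTop (nhds 0)) :
    Filter.Tendsto (fun n => ∫ t in Icc (0:ℝ) T, (μ t (Ioo (-ε n) 0)).toReal)
      Filter.atTop (nhds 0) := by
  have hset : Antitone fun n => Ioo (-ε n) (0:ℝ) :=
    fun m n hmn => Ioo_subset_Ioo_left (neg_le_neg (hanti hmn))
  have hinter : ⋂ n, Ioo (-ε n) (0:ℝ) = ∅ := by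
    refine eq_empty_of_forall_notMem fun x hx => ?_
    rw [mem_iInter] at hx
    have : 0 ≤ x := by
      refine le_of_tendsto' (x := Filter.atTop) (f := fun n => -ε n) (by simpa using hε.neg)
        fun n => (hx n).1.le
    exact (hx 0).2.not_ge this
  suffices h : Filter.Tendsto (fun n => ∫ t in Icc (0:ℝ) T, (μ t (Ioo (-ε n) 0)).toReal)
      Filter.atTop (nhds (∫ _ in Icc (0:ℝ) T, (0:ℝ))) by simpa using h
  refine tendsto_integral_of_dominated_convergence
    (fun t => (μ t (Ioo (-ε 0) 0)).toReal)
    (fun n => (hμ.integrable_toReal_Ioo hfin _ _).aestronglyMeasurable)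
    (hμ.integrable_toReal_Ioo hfin _ _) (fun n => ?_) ?_
  · filter_upwards [ae_restrict_mem measurableSet_Icc] with t ht
    have := hfin t ht
    rw [Real.norm_of_nonneg ENNReal.toReal_nonneg]
    exact ENNReal.toReal_mono measure_Ioo_lt_top.ne (measure_mono (hset (Nat.zero_le n)))
  · filter_upwards [ae_restrict_mem measurableSet_Icc] with t ht
    have := hfin t ht
    have h := tendsto_measure_iInter_atTop (μ := μ t)
      (fun n => (measurableSet_Ioo (a := -ε n) (b := (0:ℝ))).nullMeasurableSet) hset
      ⟨0, measure_Ioo_lt_top.ne⟩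
    rw [hinter, measure_empty] at h
    simpa [Function.comp_def] using (ENNReal.tendsto_toReal ENNReal.zero_ne_top).comp h

/-- The mass of the initial datum in `[0, c)` is controlled by the mass that the solution puts
just to the left of the origin. -/
theorem integral_max_sq_le_of_isMVSolution {T c ε : ℝ} {μ : ℝ → Measure ℝ} {μ₀ : Measure ℝ}
    (hc : 0 ≤ c) (hε : 0 < ε) (hcε : c + ε < T) (hμ₀ : ∀ᵐ x ∂μ₀, 0 ≤ x)
    (hfin : ∀ t ∈ Icc (0:ℝ) T, IsLocallyFiniteMeasure (μ t)) (hμ : IsMeasurableFamily T μ)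
    (hsol : IsMVSolution T (fun _ y => bEx y) μ μ₀) :
    ∫ x, (max (c - x) 0) ^ 2 ∂μ₀ ≤
      4 * (c + ε) * ∫ t in Icc (0:ℝ) T, (μ t (Ioo (-ε) 0)).toReal := by
  have hae := hsol (coneTest c ε) (contDiff_coneTest c ε)
    ⟨c + ε, by linarith, fun t ht x hx => coneTest_eq_zero hε (by
      rw [Real.norm_eq_abs] at hx; linarith [ht.1])⟩
  have hne : volume.restrict (Ioc (c + ε) T) ≠ 0 := by
    rw [Ne, Measure.restrict_eq_zero, Real.volume_Ioc]
    simpa using hcε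
  have hsub : Ioc (c + ε) T ⊆ Icc 0 T := fun t ht => ⟨by linarith [ht.1], ht.2⟩
  have : NeZero (volume.restrict (Ioc (c + ε) T)) := ⟨hne⟩
  obtain ⟨t, ht, hmem⟩ := ((ae_restrict_of_ae_restrict_of_subset hsub hae).and
    (ae_restrict_mem measurableSet_Ioc)).exists
  have hzero : ∫ x, coneTest c ε (t, x) ∂(μ t) = 0 := by
    rw [integral_congr_ae (Filter.Eventually.of_forall fun x => coneTest_eq_zero hε
      (by linarith [hmem.1, abs_nonneg x]))]
    simp
  have hinit : ∫ x, coneTest c ε (0, x) ∂μ₀ = ∫ x, (max (c - x) 0) ^ 2 ∂μ₀ := by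
    refine integral_congr_ae ?_
    filter_upwards [hμ₀] with x hx
    simp [coneTest, oneSidedAbs_of_nonneg hε hx]
  have ht0 : 0 ≤ t := (hsub hmem).1
  have hsub' : Ioc 0 t ⊆ Icc 0 T := fun s hs => ⟨hs.1.le, hs.2.trans hmem.2⟩
  have hint := (hμ.integrable_toReal_Ioo hfin (-ε) 0).const_mul (4 * (c + ε))
  have hbound : ‖∫ s in (0:ℝ)..t, (∫ x, (deriv (fun τ => coneTest c ε (τ, x)) s
        + fderiv ℝ (fun y => coneTest c ε (s, y)) x (bEx x)) ∂(μ s))‖ ≤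
      ∫ s in Icc (0:ℝ) T, 4 * (c + ε) * (μ s (Ioo (-ε) 0)).toReal := by
    rw [intervalIntegral.integral_of_le ht0]
    refine (norm_integral_le_of_norm_le (IntegrableOn.mono_set hint hsub') ?_).trans
      (setIntegral_mono_set hint ?_ hsub'.eventuallyLE)
    · filter_upwards [ae_restrict_mem measurableSet_Ioc] with s hs
      have := hfin s (hsub' hs)
      exact norm_integral_transport_coneTest_le hc hε hs.1.le
    · exact Filter.Eventually.of_forall fun s =>
        mul_nonneg (by linarith) ENNReal.toReal_nonneg
  rw [integral_const_mul, Real.norm_eq_abs] at hbound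
  rw [hzero, hinit] at ht
  linarith [neg_abs_le (∫ s in (0:ℝ)..t, (∫ x, (deriv (fun τ => coneTest c ε (τ, x)) s
        + fderiv ℝ (fun y => coneTest c ε (s, y)) x (bEx x)) ∂(μ s)))]

theorem exists_measure_Ico_ne_zero {T : ℝ} {ν : Measure ℝ} (h : ν (Ico 0 T) ≠ 0) :
    ∃ c, 0 ≤ c ∧ c < T ∧ ν (Ico 0 c) ≠ 0 := by
  by_contra! hcon
  refine h (measure_mono_null (t := ⋃ n : ℕ, Ico 0 (T - 1 / ((n:ℝ) + 1))) ?_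
    (measure_iUnion_null fun n => ?_))
  · intro x hx
    obtain ⟨n, hn⟩ := exists_nat_one_div_lt (sub_pos.2 hx.2)
    exact mem_iUnion.2 ⟨n, hx.1, by linarith⟩
  · rcases le_total 0 (T - 1 / ((n:ℝ) + 1)) with hn | hn
    · exact hcon _ hn (sub_lt_self _ Nat.one_div_pos_of_nat)
    · rw [Ico_eq_empty hn.not_gt, measure_empty]

theorem integral_max_sq_pos {T c : ℝ} {ν : Measure ℝ} [IsLocallyFiniteMeasure ν]
    (hν : ν (Ico (0:ℝ) T)ᶜ = 0) (hc : ν (Ico 0 c) ≠ 0) :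
    0 < ∫ x, (max (c - x) 0) ^ 2 ∂ν := by
  have hrestrict : ν.restrict (Icc 0 T) = ν :=
    Measure.restrict_eq_self_of_ae_mem (measure_mono_null
      (compl_subset_compl.2 Ico_subset_Icc_self) hν)
  have hint : Integrable (fun x : ℝ => (max (c - x) 0) ^ 2) ν := by
    rw [← hrestrict]
    exact (Continuous.continuousOn (by fun_prop)).integrableOn_compact isCompact_Icc
  rw [integral_pos_iff_support_of_nonneg (fun x => sq_nonneg _) hint]
  refine (pos_iff_ne_zero.2 hc).trans_le (measure_mono fun x hx => ?_)
  have : 0 < c - x := sub_pos.2 hx.2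
  simp [max_eq_left this.le, this.ne']

/-- For `b(x) = -1` for `x ≥ 0`, `b(x) = 1` for `x < 0`, and any nonzero nonnegative locally
finite Borel measure `μ̄` concentrated on `[0,T)`, the continuity equation
`∂_t μ_t + div (b μ_t) = 0` with initial datum `μ̄` has no measure-valued solution given by a
measurable family of nonnegative locally finite Borel measures. -/
theorem no_nonneg_mvs_for_bEx
    (T : ℝ) (hT : 0 < T) (μ₀ : Measure ℝ) [IsLocallyFiniteMeasure μ₀]
    (hμ₀_ne : μ₀ ≠ 0) (hμ₀_conc : μ₀ (Set.Ico (0:ℝ) T)ᶜ = 0) :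
    ¬ ∃ μ : ℝ → Measure ℝ,
        (∀ t ∈ Set.Icc (0:ℝ) T, IsLocallyFiniteMeasure (μ t)) ∧
        IsMeasurableFamily T μ ∧
        IsMVSolution T (fun _ y => bEx y) μ μ₀ := by
  rintro ⟨μ, hfin, hμ, hsol⟩
  have hmass : μ₀ (Ico 0 T) ≠ 0 := fun h =>
    hμ₀_ne (Measure.measure_univ_eq_zero.1 (by
      rw [← union_compl_self (Ico 0 T)]; exact measure_union_null h hμ₀_conc))
  obtain ⟨c, hc0, hcT, hc⟩ := exists_measure_Ico_ne_zero hmass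
  have hpos := integral_max_sq_pos hμ₀_conc hc
  have hnonneg : ∀ᵐ x ∂μ₀, 0 ≤ x := by
    filter_upwards [mem_ae_iff.2 hμ₀_conc] with x hx using hx.1
  have hanti : Antitone fun n : ℕ => 1 / ((n:ℝ) + 1) := fun m n hmn =>
    Nat.one_div_le_one_div hmn
  have hε : Filter.Tendsto (fun n : ℕ => 1 / ((n:ℝ) + 1)) Filter.atTop (nhds 0) :=
    tendsto_one_div_add_atTop_nhds_zero_nat
  have hlim := ((hε.const_add c).const_mul 4).mul
    (hμ.tendsto_integral_toReal_Ioo hfin hanti hε)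
  rw [mul_zero] at hlim
  refine hpos.not_ge (ge_of_tendsto hlim ?_)
  filter_upwards [hε.eventually (gt_mem_nhds (sub_pos.2 hcT))] with n hn
  exact integral_max_sq_le_of_isMVSolution hc0 Nat.one_div_pos_of_nat (by linarith) hnonneg
    hfin hμ hsol

end
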